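/- Let G be a digraph with transitive closure Ḡ, let f̄ be a discrete Morse function on Ḡ, and let V̄ = grad f̄ be the discrete gradient vector field on Ḡ. Suppose Ω_*(G) is V̄-invariant, i.e., V̄(Ω_n(G)) ⊆ Ω_{n+1}(G) for all n. Define C_n = span_ℝ{ α + V̄∂(α) : α a critical allowed elementary n-path on Ḡ } ∩ Ω_n(G). Then ∂_n(C_n) ⊆ C_{n−1}, and for every m ≥ 0, H_m(G;ℝ) ≅ H_m({C_n, ∂_n}). -/

import Mathlib

open scoped BigOperators Classical

namespace PathMorse

/-- A digraph: an irreflexive edge relation on a vertex set. -/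
structure Digraph (V : Type) where
  E : V → V → Prop
  irrefl : ∀ v, ¬ E v v

/-- A digraph is transitive if `u→v` and `v→w` imply `u→w`. -/
def Digraph.Transitive {V : Type} (G : Digraph V) : Prop :=
  ∀ u v w, G.E u v → G.E v w → G.E u w

/-- `Gbar` is the transitive closure of `G`: the smallest transitive digraph containing `G`. -/
def IsTransClosure {V : Type} (G Gbar : Digraph V) : Prop :=
  Gbar.Transitive ∧ (∀ u v, G.E u v → Gbar.E u v) ∧
    ∀ H : Digraph V, H.Transitive → (∀ u v, G.E u v → H.E u v) →
      ∀ u v, Gbar.E u v → H.E u v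

/-- An elementary `n`-path on `V`: a sequence of `n+1` vertices. -/
abbrev Path (V : Type) (n : ℕ) := Fin (n+1) → V

/-- An elementary path is allowed on `G` if consecutive vertices are joined by directed edges. -/
def Allowed {V : Type} (G : Digraph V) {n : ℕ} (p : Path V n) : Prop :=
  ∀ i : Fin n, G.E (p i.castSucc) (p i.succ)

/-- The `i`-th face of a path: delete the `i`-th vertex. -/
def face {V : Type} {n : ℕ} (i : Fin (n+2)) (p : Path V (n+1)) : Path V n :=
  p ∘ i.succAbove

/-- `q` is obtained from `p` by deleting one vertex (the codimension-one relation `q < p`). -/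
def IsFace {V : Type} {n : ℕ} (q : Path V n) (p : Path V (n+1)) : Prop :=
  ∃ i : Fin (n+2), face i p = q

/-- Value of `f` on a path: sum of the values at the vertices. -/
def fPath {V : Type} (f : V → ℝ) {n : ℕ} (p : Path V n) : ℝ :=
  ∑ i, f (p i)

/-- There is an allowed coface `γ > p` with `f γ = f p`. -/
def HasEqualCoface {V : Type} (G : Digraph V) (f : V → ℝ) {n : ℕ} (p : Path V n) : Prop :=
  ∃ γ : Path V (n+1), Allowed G γ ∧ IsFace p γ ∧ fPath f γ = fPath f p

/-- There is an allowed face `β < p` with `f β = f p`. -/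
def HasEqualFace {V : Type} (G : Digraph V) (f : V → ℝ) : (n : ℕ) → Path V n → Prop
  | 0, _ => False
  | (n+1), p => ∃ β : Path V n, Allowed G β ∧ IsFace β p ∧ fPath f β = fPath f p

/-- A discrete Morse function on a digraph: nonnegative, and for each allowed elementary path
there is at most one allowed coface with the same value, and at most one allowed face with the
same value. -/
def IsMorse {V : Type} (G : Digraph V) (f : V → ℝ) : Prop :=
  (∀ v, 0 ≤ f v) ∧
  (∀ n (α : Path V n), Allowed G α →
    ∀ γ₁ γ₂ : Path V (n+1), Allowed G γ₁ → Allowed G γ₂ → IsFace α γ₁ → IsFace α γ₂ →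
      fPath f γ₁ = fPath f α → fPath f γ₂ = fPath f α → γ₁ = γ₂) ∧
  (∀ n (α : Path V (n+1)), Allowed G α →
    ∀ β₁ β₂ : Path V n, Allowed G β₁ → Allowed G β₂ → IsFace β₁ α → IsFace β₂ α →
      fPath f β₁ = fPath f α → fPath f β₂ = fPath f α → β₁ = β₂)

/-- A critical path: allowed, with no allowed coface of equal value, no allowed face of equal value. -/
def IsCritical {V : Type} (G : Digraph V) (f : V → ℝ) {n : ℕ} (p : Path V n) : Prop :=
  Allowed G p ∧ ¬ HasEqualCoface G f p ∧ ¬ HasEqualFace G f n p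

/-- `n`-chains: the real vector space with (orthonormal) basis the elementary `n`-paths. -/
abbrev Chain (V : Type) (n : ℕ) := Path V n → ℝ

variable {V : Type} [Fintype V] [DecidableEq V]

/-- The basis chain corresponding to an elementary path. -/
def unitP {n : ℕ} (p : Path V n) : Chain V n := Pi.single p 1

/-- The boundary operator on chains (as a bare function). -/
def boundaryFun {n : ℕ} (x : Chain V (n+1)) : Chain V n :=
  fun q => ∑ p : Path V (n+1), x p * ∑ i : Fin (n+2), ((-1:ℝ)^(i:ℕ)) * (if face i p = q then 1 else 0)

/-- The boundary operator `∂ = Σ (-1)^i d_i` as a linear map. -/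
def boundary (V : Type) [Fintype V] [DecidableEq V] (n : ℕ) : Chain V (n+1) →ₗ[ℝ] Chain V n where
  toFun := boundaryFun
  map_add' x y := by
    funext q
    simp [boundaryFun, add_mul, Finset.sum_add_distrib]
  map_smul' c x := by
    funext q
    simp [boundaryFun, Finset.mul_sum, mul_assoc]

/-- `P_n(G)`: the span of the allowed elementary `n`-paths. -/
def pSpan (G : Digraph V) (n : ℕ) : Submodule ℝ (Chain V n) :=
  Submodule.span ℝ {x : Chain V n | ∃ p : Path V n, Allowed G p ∧ x = unitP p}

/-- `Ω_n(G) = {x ∈ P_n(G) : ∂x ∈ P_{n-1}(G)}` (with `Ω_0 = P_0`). -/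
def omega (G : Digraph V) : (n : ℕ) → Submodule ℝ (Chain V n)
  | 0 => pSpan G 0
  | (n+1) => pSpan G (n+1) ⊓ (pSpan G n).comap (boundary V n)

/-- The discrete gradient vector field on a basis path: `V(α) = -⟨∂γ,α⟩ γ` if there is an
allowed coface `γ > α` with `f γ = f α`, and `0` otherwise. -/
noncomputable def gradFun (G : Digraph V) (f : V → ℝ) {n : ℕ} (α : Path V n) : Chain V (n+1) :=
  if h : Allowed G α ∧ ∃ γ : Path V (n+1), Allowed G γ ∧ IsFace α γ ∧ fPath f γ = fPath f α then
    (-(boundary V n (unitP h.2.choose) α)) • unitP h.2.choose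
  else 0

/-- The discrete gradient vector field `V = grad f`, extended linearly to chains. -/
noncomputable def grad (G : Digraph V) (f : V → ℝ) (n : ℕ) : Chain V n →ₗ[ℝ] Chain V (n+1) where
  toFun x := ∑ α : Path V n, x α • gradFun G f α
  map_add' x y := by simp [add_smul, Finset.sum_add_distrib]
  map_smul' c x := by simp [Finset.smul_sum, smul_smul]

/-- The composite `V∂` in degree `n` (zero in degree `0`). -/
noncomputable def vd (G : Digraph V) (f : V → ℝ) : (n : ℕ) → (Chain V n →ₗ[ℝ] Chain V n)
  | 0 => 0
  | (n+1) => (grad G f n).comp (boundary V n)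

/-- The discrete gradient flow `Φ = Id + ∂V + V∂`. -/
noncomputable def flow (G : Digraph V) (f : V → ℝ) (n : ℕ) : Chain V n →ₗ[ℝ] Chain V n :=
  LinearMap.id + (boundary V n).comp (grad G f n) + vd G f n

/-- `P_n^Φ(G) = {x ∈ P_n(G) : Φ x = x}`. -/
noncomputable def pPhi (G : Digraph V) (f : V → ℝ) (n : ℕ) : Submodule ℝ (Chain V n) :=
  pSpan G n ⊓ LinearMap.ker (flow G f n - LinearMap.id)

/-- The cycles of a chain complex of subspaces `C` with differentials `D`
(in degree `0`, everything is a cycle). -/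
def cycles (C : ∀ n, Submodule ℝ (Chain V n)) (D : ∀ n, Chain V (n+1) →ₗ[ℝ] Chain V n) :
    (m : ℕ) → Submodule ℝ (Chain V m)
  | 0 => C 0
  | (m+1) => C (m+1) ⊓ LinearMap.ker (D m)

/-- Homology of the chain complex `(C, D)`: cycles modulo boundaries coming from `C`. -/
abbrev Homology (C : ∀ n, Submodule ℝ (Chain V n)) (D : ∀ n, Chain V (n+1) →ₗ[ℝ] Chain V n)
    (m : ℕ) :=
  (cycles C D m) ⧸ (Submodule.comap (cycles C D m).subtype ((C (m+1)).map (D m)))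

/-- The operator `e^{tf}` on chains. -/
noncomputable def expOp (f : V → ℝ) (t : ℝ) (n : ℕ) : Chain V n →ₗ[ℝ] Chain V n where
  toFun x := fun p => Real.exp (t * fPath f p) * x p
  map_add' x y := by funext p; simp [mul_add]
  map_smul' c x := by funext p; simp; ring

/-- The deformed boundary `∂_t = e^{tf} ∂ e^{-tf}`. -/
noncomputable def dT (f : V → ℝ) (t : ℝ) (n : ℕ) : Chain V (n+1) →ₗ[ℝ] Chain V n :=
  (expOp f t n).comp ((boundary V n).comp (expOp f (-t) (n+1)))

/-- The span of the elementary `n`-paths that are critical in `Gbar` and allowed in `G`. -/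
def critSpan (G Gbar : Digraph V) (f : V → ℝ) (n : ℕ) : Submodule ℝ (Chain V n) :=
  Submodule.span ℝ {x : Chain V n | ∃ α : Path V n, IsCritical Gbar f α ∧ Allowed G α ∧ x = unitP α}

section DirectedPaths

variable {V : Type} {n : ℕ} {G : Digraph V} {f : V → ℝ}

theorem Allowed.edge_of_lt {p : Path V n} (hp : Allowed G p) (hG : G.Transitive)
    {i j : Fin (n + 1)} (hij : i < j) : G.E (p i) (p j) := by
  have : IsTrans V G.E := ⟨hG⟩
  exact Fin.liftFun_iff_succ G.E |>.2 hp hij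

theorem Allowed.injective {p : Path V n} (hp : Allowed G p) (hG : G.Transitive) :
    Function.Injective p := by
  intro i j h
  rcases lt_trichotomy i j with hij | hij | hij
  · exact absurd (h ▸ hp.edge_of_lt hG hij) (G.irrefl _)
  · exact hij
  · exact absurd (h ▸ hp.edge_of_lt hG hij) (G.irrefl _)

theorem Allowed.face {p : Path V (n + 1)} (hp : Allowed G p) (hG : G.Transitive)
    (i : Fin (n + 2)) : Allowed G (face i p) := fun j =>
  hp.edge_of_lt hG (Fin.strictMono_succAbove i j.castSucc_lt_succ)

theorem face_left_injective {p : Path V (n + 1)} (hp : Function.Injective p) :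
    Function.Injective fun i => face i p := by
  intro i j h
  have h' : i.succAbove = j.succAbove := hp.comp_left h
  exact Fin.succAbove_left_injective h'

theorem fPath_eq_add_face (f : V → ℝ) (p : Path V (n + 1)) (i : Fin (n + 2)) :
    fPath f p = f (p i) + fPath f (face i p) :=
  Fin.sum_univ_succAbove (fun j => f (p j)) i

theorem fPath_eq_face_iff {p : Path V (n + 1)} {i : Fin (n + 2)} :
    fPath f p = fPath f (face i p) ↔ f (p i) = 0 := by
  rw [fPath_eq_add_face f p i, add_eq_right]

/-- An allowed path contains at most one zero of a discrete Morse function. -/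
theorem IsMorse.zero_unique (hG : G.Transitive) (hf : IsMorse G f) {p : Path V n}
    (hp : Allowed G p) {i j : Fin (n + 1)} (hi : f (p i) = 0) (hj : f (p j) = 0) : i = j := by
  cases n with
  | zero => exact (Subsingleton.elim (α := Fin 1) i j :)
  | succ n =>
    exact face_left_injective (hp.injective hG) <|
      hf.2.2 n p hp _ _ (hp.face hG i) (hp.face hG j) ⟨i, rfl⟩ ⟨j, rfl⟩
        (fPath_eq_face_iff.2 hi).symm (fPath_eq_face_iff.2 hj).symm

theorem not_hasEqualCoface_of_zero (hG : G.Transitive) (hf : IsMorse G f) {p : Path V n}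
    {i : Fin (n + 1)} (hi : f (p i) = 0) : ¬ HasEqualCoface G f p := by
  rintro ⟨γ, hγ, ⟨k, rfl⟩, he⟩
  exact Fin.succAbove_ne k i (hf.zero_unique hG hγ hi (fPath_eq_face_iff.1 he))

/-- A path with an equal-valued coface is a face of an allowed path, opposite to a
zero of the Morse function. -/
theorem hasEqualCoface_cases {p : Path V n} (h : HasEqualCoface G f p) :
    ∃ γ : Path V (n + 1), ∃ i, Allowed G γ ∧ f (γ i) = 0 ∧ p = face i γ := by
  obtain ⟨γ, hγ, ⟨i, rfl⟩, he⟩ := h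
  exact ⟨γ, i, hγ, fPath_eq_face_iff.1 he, rfl⟩

theorem face_face_swap (p : Path V (n + 2)) (i : Fin (n + 3)) (j : Fin (n + 2)) :
    face (j.predAbove i) (face (i.succAbove j) p) = face j (face i p) := by
  funext k
  simp only [face, Function.comp_apply]
  rw [Fin.succAbove_succAbove_succAbove_predAbove]

end DirectedPaths

section Chains

theorem linearMap_ext_unitP {M : Type*} [AddCommGroup M] [Module ℝ M] {n : ℕ}
    {A B : Chain V n →ₗ[ℝ] M} (h : ∀ p, A (unitP p) = B (unitP p)) : A = B :=
  LinearMap.pi_ext' fun p => LinearMap.ext_ring (h p)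

theorem boundary_unitP {n : ℕ} (p : Path V (n + 1)) :
    boundary V n (unitP p) = ∑ i : Fin (n + 2), ((-1 : ℝ) ^ (i : ℕ)) • unitP (face i p) := by
  funext q
  change boundaryFun (unitP p) q = _
  rw [boundaryFun, Finset.sum_eq_single p]
  · simp [unitP, Pi.single_apply, eq_comm]
  · intro b _ hb
    simp [unitP, hb]
  · simp

theorem neg_one_pow_succAbove_mul_predAbove {n : ℕ} (i : Fin (n + 2)) (j : Fin (n + 1)) :
    (-1 : ℝ) ^ (i.succAbove j : ℕ) * (-1) ^ (j.predAbove i : ℕ) =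
      -((-1) ^ (i : ℕ) * (-1) ^ (j : ℕ)) := by
  rcases lt_or_ge j.castSucc i with h | h
  · rw [Fin.succAbove_of_castSucc_lt _ _ h, Fin.predAbove_of_castSucc_lt _ _ h]
    obtain ⟨k, rfl⟩ := Fin.exists_succ_eq.2 (Fin.ne_zero_of_lt h)
    simp [pow_succ, mul_comm]
  · rw [Fin.succAbove_of_le_castSucc _ _ h, Fin.predAbove_of_le_castSucc _ _ h]
    simp [pow_succ, mul_comm]

theorem boundary_boundary {n : ℕ} (x : Chain V (n + 2)) :
    boundary V n (boundary V (n + 1) x) = 0 := by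
  suffices h : (boundary V n).comp (boundary V (n + 1)) = 0 from LinearMap.congr_fun h x
  refine linearMap_ext_unitP fun p => ?_
  simp only [LinearMap.comp_apply, boundary_unitP, map_sum, map_smul, Finset.smul_sum, smul_smul,
    LinearMap.zero_apply]
  rw [← Fintype.sum_prod_type' (f := fun (i : Fin (n + 3)) (j : Fin (n + 2)) =>
    ((-1 : ℝ) ^ (i : ℕ) * (-1) ^ (j : ℕ)) • unitP (face j (face i p)))]
  refine Finset.sum_involution (fun a _ => (a.1.succAbove a.2, a.2.predAbove a.1)) ?_ ?_ ?_ ?_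
  · intro a _
    rw [neg_one_pow_succAbove_mul_predAbove, face_face_swap, neg_smul, add_neg_cancel]
  · intro a _ _ h
    exact Fin.succAbove_ne _ _ (congrArg Prod.fst h)
  · simp
  · rintro ⟨i, j⟩ _
    exact Prod.ext (Fin.succAbove_succAbove_predAbove i j) (Fin.predAbove_predAbove_succAbove i j)

theorem boundary_mem_omega {G : Digraph V} {n : ℕ} {x : Chain V (n + 1)}
    (hx : x ∈ omega G (n + 1)) : boundary V n x ∈ omega G n := by
  cases n with
  | zero => exact hx.2
  | succ n =>
    refine ⟨hx.2, ?_⟩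
    change boundary V n (boundary V (n + 1) x) ∈ pSpan G n
    rw [boundary_boundary]
    exact zero_mem _

theorem omega_le_pSpan (G : Digraph V) (n : ℕ) : omega G n ≤ pSpan G n := by
  cases n with
  | zero => exact le_rfl
  | succ n => exact inf_le_left

theorem pSpan_mono {V : Type} [DecidableEq V] {G H : Digraph V} (h : ∀ u v, G.E u v → H.E u v) (n : ℕ) :
    pSpan G n ≤ pSpan H n := by
  refine Submodule.span_mono ?_
  rintro _ ⟨p, hp, rfl⟩
  exact ⟨p, fun i => h _ _ (hp i), rfl⟩

end Chains

section Gradient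

variable {G : Digraph V} {f : V → ℝ} {n : ℕ}

theorem grad_unitP (p : Path V n) : grad G f n (unitP p) = gradFun G f p := by
  change ∑ α : Path V n, unitP p α • gradFun G f α = _
  rw [Finset.sum_eq_single p]
  · simp [unitP]
  · intro b _ hb
    simp [unitP, hb]
  · simp

theorem gradFun_eq_zero {p : Path V n} (h : ¬ HasEqualCoface G f p) : gradFun G f p = 0 :=
  dif_neg fun h' => h h'.2

theorem gradFun_face (hG : G.Transitive) (hf : IsMorse G f) {γ : Path V (n + 1)}
    (hγ : Allowed G γ) {i : Fin (n + 2)} (hi : f (γ i) = 0) :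
    gradFun G f (face i γ) = (-(-1 : ℝ) ^ (i : ℕ)) • unitP γ := by
  have h : Allowed G (face i γ) ∧ ∃ γ' : Path V (n + 1), Allowed G γ' ∧ IsFace (face i γ) γ' ∧
      fPath f γ' = fPath f (face i γ) :=
    ⟨hγ.face hG i, γ, hγ, ⟨i, rfl⟩, fPath_eq_face_iff.2 hi⟩
  have hc : h.2.choose = γ := hf.2.1 n _ h.1 _ _ h.2.choose_spec.1 hγ h.2.choose_spec.2.1 ⟨i, rfl⟩
    h.2.choose_spec.2.2 (fPath_eq_face_iff.2 hi)
  rw [gradFun, dif_pos h, hc, boundary_unitP, Finset.sum_apply, Finset.sum_eq_single i]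
  · simp [unitP]
  · intro j _ hj
    have : face i γ ≠ face j γ := fun e => hj (face_left_injective (hγ.injective hG) e).symm
    simp [unitP, this]
  · simp

theorem gradFun_of_zero (hG : G.Transitive) (hf : IsMorse G f) {p : Path V n}
    {i : Fin (n + 1)} (hi : f (p i) = 0) : gradFun G f p = 0 :=
  gradFun_eq_zero (not_hasEqualCoface_of_zero hG hf hi)

theorem gradFun_face_of_ne (hG : G.Transitive) (hf : IsMorse G f) {γ : Path V (n + 1)}
    {i j : Fin (n + 2)} (hi : f (γ i) = 0) (hj : j ≠ i) : gradFun G f (face j γ) = 0 := by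
  obtain ⟨k, hk⟩ := Fin.exists_succAbove_eq hj.symm
  exact gradFun_of_zero hG hf (i := k) (by simpa [face, hk] using hi)

theorem grad_grad (hG : G.Transitive) (hf : IsMorse G f) (x : Chain V n) :
    grad G f (n + 1) (grad G f n x) = 0 := by
  suffices h : (grad G f (n + 1)).comp (grad G f n) = 0 from LinearMap.congr_fun h x
  refine linearMap_ext_unitP fun p => ?_
  rw [LinearMap.comp_apply, grad_unitP, LinearMap.zero_apply]
  by_cases h : HasEqualCoface G f p
  · obtain ⟨γ, i, hγ, hi, rfl⟩ := hasEqualCoface_cases h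
    rw [gradFun_face hG hf hγ hi, map_smul, grad_unitP, gradFun_of_zero hG hf hi, smul_zero]
  · rw [gradFun_eq_zero h, map_zero]

theorem grad_boundary_of_zero (hG : G.Transitive) (hf : IsMorse G f) {γ : Path V (n + 1)}
    (hγ : Allowed G γ) {i : Fin (n + 2)} (hi : f (γ i) = 0) :
    grad G f n (boundary V n (unitP γ)) = -unitP γ := by
  rw [boundary_unitP, map_sum, Finset.sum_eq_single i]
  · rw [map_smul, grad_unitP, gradFun_face hG hf hγ hi, smul_smul, mul_neg, ← pow_add,
      Even.neg_one_pow ⟨_, rfl⟩, neg_smul, one_smul]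
  · intro j _ hj
    rw [map_smul, grad_unitP, gradFun_face_of_ne hG hf hi hj, smul_zero]
  · simp

theorem grad_boundary_grad (hG : G.Transitive) (hf : IsMorse G f) (x : Chain V n) :
    grad G f n (boundary V n (grad G f n x)) = -grad G f n x := by
  suffices h : (grad G f n).comp ((boundary V n).comp (grad G f n)) = -grad G f n from
    LinearMap.congr_fun h x
  refine linearMap_ext_unitP fun p => ?_
  rw [LinearMap.comp_apply, LinearMap.comp_apply, LinearMap.neg_apply, grad_unitP]
  by_cases h : HasEqualCoface G f p
  · obtain ⟨γ, i, hγ, hi, rfl⟩ := hasEqualCoface_cases h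
    rw [gradFun_face hG hf hγ hi, map_smul, map_smul, grad_boundary_of_zero hG hf hγ hi, smul_neg]
  · rw [gradFun_eq_zero h, map_zero, map_zero, neg_zero]

end Gradient

section Flow

variable {G : Digraph V} {f : V → ℝ} {n : ℕ}

theorem flow_apply (x : Chain V n) :
    flow G f n x = x + boundary V n (grad G f n x) + vd G f n x := rfl

theorem vd_succ_apply (x : Chain V (n + 1)) :
    vd G f (n + 1) x = grad G f n (boundary V n x) := rfl

theorem vd_boundary (x : Chain V (n + 1)) : vd G f n (boundary V n x) = 0 := by
  cases n with
  | zero => rfl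
  | succ n => rw [vd_succ_apply, boundary_boundary, map_zero]

theorem flow_boundary (x : Chain V (n + 1)) :
    flow G f n (boundary V n x) = boundary V n (flow G f (n + 1) x) := by
  rw [flow_apply, flow_apply, vd_boundary, map_add, map_add, boundary_boundary, vd_succ_apply,
    add_zero, add_zero]

theorem flow_grad (hG : G.Transitive) (hf : IsMorse G f) (x : Chain V n) :
    flow G f (n + 1) (grad G f n x) = 0 := by
  rw [flow_apply, grad_grad hG hf, map_zero, vd_succ_apply, grad_boundary_grad hG hf]
  simp

theorem flow_boundary_grad (hG : G.Transitive) (hf : IsMorse G f) (x : Chain V n) :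
    flow G f n (boundary V n (grad G f n x)) = 0 := by
  rw [flow_boundary, flow_grad hG hf, map_zero]

theorem flow_vd (hG : G.Transitive) (hf : IsMorse G f) (x : Chain V n) :
    flow G f n (vd G f n x) = 0 := by
  cases n with
  | zero => exact map_zero _
  | succ n => exact flow_grad hG hf _

theorem flow_flow (hG : G.Transitive) (hf : IsMorse G f) (x : Chain V n) :
    flow G f n (flow G f n x) = flow G f n x := by
  conv_lhs => rw [flow_apply x, map_add, map_add, flow_boundary_grad hG hf, flow_vd hG hf,
    add_zero, add_zero]

theorem flow_mem_omega {H : Digraph V} (hinv : ∀ n, ∀ x ∈ omega G n, grad H f n x ∈ omega G (n + 1))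
    {x : Chain V n} (hx : x ∈ omega G n) : flow H f n x ∈ omega G n := by
  refine add_mem (add_mem hx (boundary_mem_omega (hinv n x hx))) ?_
  cases n with
  | zero => exact zero_mem _
  | succ n => exact hinv n _ (boundary_mem_omega hx)

theorem flow_of_critical {p : Path V n} (hp : IsCritical G f p) :
    flow G f n (unitP p) = unitP p + vd G f n (unitP p) := by
  rw [flow_apply, grad_unitP, gradFun_eq_zero hp.2.1, map_zero, add_zero]

/-- The span of the flow-invariant chains attached to the critical paths. -/
noncomputable def criticalChains (G : Digraph V) (f : V → ℝ) (n : ℕ) : Submodule ℝ (Chain V n) :=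
  Submodule.span ℝ {x : Chain V n | ∃ α : Path V n,
    IsCritical G f α ∧ x = unitP α + vd G f n (unitP α)}

theorem flow_of_critical_mem {p : Path V n} (hp : IsCritical G f p) :
    flow G f n (unitP p) ∈ criticalChains G f n :=
  Submodule.subset_span ⟨p, hp, flow_of_critical hp⟩

theorem flow_of_mem_criticalChains (hG : G.Transitive) (hf : IsMorse G f) {x : Chain V n}
    (hx : x ∈ criticalChains G f n) : flow G f n x = x := by
  refine LinearMap.eqOn_span (f := flow G f n) (g := LinearMap.id) ?_ hx
  rintro _ ⟨p, hp, rfl⟩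
  rw [← flow_of_critical hp, flow_flow hG hf, LinearMap.id_apply]

theorem flow_mem_criticalChains_of_zero (hG : G.Transitive) (hf : IsMorse G f) {p : Path V n}
    (hp : Allowed G p) {i : Fin (n + 1)} (hi : f (p i) = 0) :
    flow G f n (unitP p) ∈ criticalChains G f n := by
  cases n with
  | zero => exact flow_of_critical_mem ⟨hp, not_hasEqualCoface_of_zero hG hf hi, id⟩
  | succ n =>
    rw [flow_apply, grad_unitP, gradFun_of_zero hG hf hi, vd_succ_apply,
      grad_boundary_of_zero hG hf hp hi]
    simp

theorem flow_unitP_mem_criticalChains (hG : G.Transitive) (hf : IsMorse G f) {p : Path V n}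
    (hp : Allowed G p) : flow G f n (unitP p) ∈ criticalChains G f n := by
  by_cases hz : ∃ i, f (p i) = 0
  · exact flow_mem_criticalChains_of_zero hG hf hp hz.choose_spec
  by_cases hc : HasEqualCoface G f p
  · obtain ⟨γ, i, hγ, hi, rfl⟩ := hasEqualCoface_cases hc
    have h0 : flow G f n (boundary V n (unitP γ)) = 0 := by
      rw [← neg_neg (unitP γ), ← grad_boundary_of_zero hG hf hγ hi, map_neg, map_neg,
        flow_boundary_grad hG hf, neg_zero]
    rw [boundary_unitP, map_sum, Fintype.sum_eq_add_sum_compl i] at h0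
    have h1 := eq_neg_of_add_eq_zero_left h0
    rw [map_smul] at h1
    rw [← Submodule.smul_mem_iff _ (pow_ne_zero (i : ℕ) (neg_ne_zero.2 (one_ne_zero (α := ℝ)))), h1]
    refine neg_mem (sum_mem fun j hj => ?_)
    rw [map_smul]
    refine Submodule.smul_mem _ _ ?_
    have hji : j ≠ i := by simpa using hj
    obtain ⟨k, hk⟩ := Fin.exists_succAbove_eq hji.symm
    exact flow_mem_criticalChains_of_zero hG hf (hγ.face hG j) (i := k)
      (by simpa [face, hk] using hi)
  · refine flow_of_critical_mem ⟨hp, hc, fun h => hz ?_⟩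
    cases n with
    | zero => exact h.elim
    | succ n =>
      obtain ⟨_, _, ⟨i, rfl⟩, he⟩ := h
      exact ⟨i, fPath_eq_face_iff.1 he.symm⟩

theorem flow_mem_criticalChains (hG : G.Transitive) (hf : IsMorse G f) {x : Chain V n}
    (hx : x ∈ pSpan G n) : flow G f n x ∈ criticalChains G f n := by
  suffices h : pSpan G n ≤ (criticalChains G f n).comap (flow G f n) from h hx
  refine Submodule.span_le.2 ?_
  rintro _ ⟨p, hp, rfl⟩
  exact flow_unitP_mem_criticalChains hG hf hp

end Flow

section Homology

variable {V : Type} {C D : ∀ n, Submodule ℝ (Chain V n)} {d : ∀ n, Chain V (n + 1) →ₗ[ℝ] Chain V n}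

theorem cycles_le (C : ∀ n, Submodule ℝ (Chain V n)) (d : ∀ n, Chain V (n + 1) →ₗ[ℝ] Chain V n)
    (m : ℕ) : cycles C d m ≤ C m := by
  cases m with
  | zero => exact le_rfl
  | succ m => exact inf_le_left

theorem cycles_mono (h : ∀ n, C n ≤ D n) (m : ℕ) : cycles C d m ≤ cycles D d m := by
  cases m with
  | zero => exact h 0
  | succ m => exact inf_le_inf_right _ (h _)

/-- A subcomplex onto which the whole complex retracts by a chain map homotopic to the identity
on cycles has the same homology. -/
theorem nonempty_homology_equiv_of_retract (hCD : ∀ n, C n ≤ D n)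
    (φ : ∀ n, Chain V n →ₗ[ℝ] Chain V n) (hφ : ∀ n, ∀ x ∈ D n, φ n x ∈ C n)
    (hfix : ∀ n, ∀ x ∈ C n, φ n x = x) (hcomm : ∀ n x, φ n (d n x) = d n (φ (n + 1) x))
    (hhom : ∀ n, ∀ x ∈ cycles D d n, ∃ y ∈ D (n + 1), d n y = φ n x - x) (m : ℕ) :
    Nonempty (Homology D d m ≃ₗ[ℝ] Homology C d m) := by
  let ι : cycles C d m →ₗ[ℝ] Homology D d m :=
    (Submodule.mkQ _).comp (Submodule.inclusion (cycles_mono hCD m))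
  have hsurj : Function.Surjective ι := by
    intro z
    obtain ⟨⟨x, hx⟩, rfl⟩ := Submodule.mkQ_surjective _ z
    have hφx : φ m x ∈ cycles C d m := by
      cases m with
      | zero => exact hφ 0 x hx
      | succ m =>
        refine ⟨hφ _ x hx.1, ?_⟩
        change d m (φ (m + 1) x) = 0
        rw [← hcomm, LinearMap.mem_ker.1 hx.2, map_zero]
    exact ⟨⟨φ m x, hφx⟩, (Submodule.Quotient.eq _).2 (hhom m x hx)⟩
  have hker : LinearMap.ker ι =
      Submodule.comap (cycles C d m).subtype ((C (m + 1)).map (d m)) := by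
    ext ⟨x, hx⟩
    rw [LinearMap.mem_ker]
    change Submodule.Quotient.mk _ = 0 ↔ ∃ y ∈ C (m + 1), d m y = x
    rw [Submodule.Quotient.mk_eq_zero]
    change (∃ y ∈ D (m + 1), d m y = x) ↔ _
    constructor
    · rintro ⟨y, hy, rfl⟩
      exact ⟨φ (m + 1) y, hφ _ y hy, by rw [← hcomm, hfix m _ (cycles_le C d m hx)]⟩
    · rintro ⟨y, hy, rfl⟩
      exact ⟨y, hCD _ hy, rfl⟩
  exact ⟨((Submodule.quotEquivOfEq _ _ hker.symm).trans
    (ι.quotKerEquivOfSurjective hsurj)).symm⟩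

end Homology

/-- If `Ω_*(G)` is `V̄`-invariant, then with
`C_n = span{α + V̄∂α : α critical on Ḡ} ∩ Ω_n(G)` one has `∂ C_n ⊆ C_{n-1}` and
`H_m(G;ℝ) ≅ H_m(C_*, ∂)`. -/
theorem stmt16 {V : Type} [Fintype V] [DecidableEq V] (G Gbar : Digraph V)
    (hcl : IsTransClosure G Gbar) (f : V → ℝ) (hf : IsMorse Gbar f)
    (hinv : ∀ n, ∀ x ∈ omega G n, grad Gbar f n x ∈ omega G (n+1)) :
    (∀ n, ∀ x ∈ (Submodule.span ℝ {x : Chain V (n+1) | ∃ α : Path V (n+1),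
          IsCritical Gbar f α ∧ x = unitP α + vd Gbar f (n+1) (unitP α)} ⊓ omega G (n+1)),
      boundary V n x ∈ (Submodule.span ℝ {x : Chain V n | ∃ α : Path V n,
          IsCritical Gbar f α ∧ x = unitP α + vd Gbar f n (unitP α)} ⊓ omega G n)) ∧
    (∀ m, Nonempty (Homology (omega G) (fun n => boundary V n) m ≃ₗ[ℝ]
      Homology (fun n => Submodule.span ℝ {x : Chain V n | ∃ α : Path V n,
          IsCritical Gbar f α ∧ x = unitP α + vd Gbar f n (unitP α)} ⊓ omega G n)
        (fun n => boundary V n) m)) := by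
  obtain ⟨hG, hle, -⟩ := hcl
  refine ⟨fun n x hx => ⟨?_, boundary_mem_omega hx.2⟩, fun m => ?_⟩
  · have hmem := flow_mem_criticalChains hG hf
      (pSpan_mono hle n (omega_le_pSpan G n (boundary_mem_omega hx.2)))
    rwa [flow_boundary, flow_of_mem_criticalChains hG hf hx.1] at hmem
  · refine nonempty_homology_equiv_of_retract (fun n => inf_le_right) (flow Gbar f)
      (fun n x hx => ⟨flow_mem_criticalChains hG hf (pSpan_mono hle n (omega_le_pSpan G n hx)),
        flow_mem_omega hinv hx⟩)
      (fun n x hx => flow_of_mem_criticalChains hG hf hx.1) (fun n x => flow_boundary x)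
      (fun n x hx => ⟨grad Gbar f n x, hinv n x (cycles_le _ _ n hx), ?_⟩) m
    have hvd : vd Gbar f n x = 0 := by
      cases n with
      | zero => rfl
      | succ n => rw [vd_succ_apply, LinearMap.mem_ker.1 hx.2, map_zero]
    rw [flow_apply, hvd, add_zero, add_sub_cancel_left]

end PathMorse
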